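/- arXiv:math/0601422 — 2 statements merged into one kernel-verified Lean document; each statement's English description precedes it below -/
import Mathlib

section
/- Let D ∈ F_p be a nonsquare, let M = [[X,Y],[Z,W]] ∈ SL₂(F_p), and let B = [[a, bD],[b, a]] ∈ SL₂(F_p) with a² − D b² = 1 and b ≠ 0. Then W² − D Z² ≠ 0, the lower-left entry of M B M^{−1} equals b(W² − D Z²) ≠ 0, and for all i, x ∈ F_p: (T_{M B M^{−1}} δ_i)(x) = Λ(W² − D Z²) · ψ((Y W − D X Z)(x² − i²)/(W² − D Z²)) · (G/√p) · Λ(−b) · ψ((a(x² + i²) − 2 x i)/(b(W² − D Z²))). -/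
open Finset

open Classical in
/-- The quadratic character of `F_p`, with values in `ℂ`. -/
noncomputable def quadChar (p : ℕ) (t : ZMod p) : ℂ :=
  if t = 0 then 0 else if IsSquare t then 1 else -1

/-- The normalized Gauss sum `G = p^{-1/2} ∑_y ψ(y²)`. -/
noncomputable def gaussSum' (p : ℕ) [NeZero p] (ψ : AddChar (ZMod p) ℂ) : ℂ :=
  (Real.sqrt p : ℂ)⁻¹ * ∑ y : ZMod p, ψ (y ^ 2)

/-- The delta function at `i`. -/
noncomputable def deltaF (p : ℕ) (i : ZMod p) : ZMod p → ℂ :=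
  fun x => if x = i then 1 else 0

/-- The Weil-representation operator `T_M` for `M = [[a,b],[c,d]]` with `c ≠ 0`. -/
noncomputable def WeilOp (p : ℕ) [Fact p.Prime] (ψ : AddChar (ZMod p) ℂ)
    (M : Matrix (Fin 2) (Fin 2) (ZMod p)) (f : ZMod p → ℂ) : ZMod p → ℂ :=
  fun x => gaussSum' p ψ / Real.sqrt p * quadChar p (-(M 1 0)) *
    ∑ i : ZMod p, ψ ((M 0 0 * x ^ 2 + M 1 1 * i ^ 2 - 2 * x * i) / M 1 0) * f i


theorem quadChar_eq_quadraticChar (p : ℕ) [Fact p.Prime] (t : ZMod p) :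
    quadChar p t = (quadraticChar (ZMod p) t : ℂ) := by
  unfold quadChar
  rw [quadraticChar_apply, quadraticCharFun]
  split_ifs <;> simp

theorem quadChar_mul (p : ℕ) [Fact p.Prime] (s t : ZMod p) :
    quadChar p (s * t) = quadChar p s * quadChar p t := by
  simp only [quadChar_eq_quadraticChar, map_mul, Int.cast_mul]

theorem weilOp_deltaF (p : ℕ) [Fact p.Prime] (ψ : AddChar (ZMod p) ℂ)
    (M : Matrix (Fin 2) (Fin 2) (ZMod p)) (i x : ZMod p) :
    WeilOp p ψ M (deltaF p i) x =
      gaussSum' p ψ / Real.sqrt p * quadChar p (-(M 1 0)) *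
        ψ ((M 0 0 * x ^ 2 + M 1 1 * i ^ 2 - 2 * x * i) / M 1 0) := by
  simp [WeilOp, deltaF]

theorem sq_sub_mul_sq_ne_zero {K : Type*} [Field K] {D : K} (hD : ¬ IsSquare D) {z w : K}
    (h : z ≠ 0 ∨ w ≠ 0) : w ^ 2 - D * z ^ 2 ≠ 0 := by
  intro h0
  by_cases hz : z = 0
  · simp_all
  · exact hD ⟨w / z, by field_simp; linear_combination -h0⟩

theorem conj_torus_eq {R : Type*} [CommRing R] {X Y Z W : R} (hdet : X * W - Y * Z = 1)
    (D a b : R) :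
    !![X, Y; Z, W] * !![a, b * D; b, a] * (!![X, Y; Z, W])⁻¹ =
      !![a + b * (Y * W - D * X * Z), b * (D * X ^ 2 - Y ^ 2);
        b * (W ^ 2 - D * Z ^ 2), a - b * (Y * W - D * X * Z)] := by
  rw [Matrix.inv_def, Matrix.det_fin_two_of, hdet, Ring.inverse_one, one_smul,
    Matrix.adjugate_fin_two_of, Matrix.mul_fin_two, Matrix.mul_fin_two]
  simp only [EmbeddingLike.apply_eq_iff_eq, Matrix.vecCons_inj, and_true]
  refine ⟨⟨?_, ?_⟩, ?_, ?_⟩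
  · linear_combination a * hdet
  · ring
  · ring
  · linear_combination a * hdet

/-- Action of a conjugated torus element on a delta function
(Lemma on `U_p(M B M⁻¹) δ_i`). -/
theorem weil_conjugated_torus_action_on_delta
    (p : ℕ) [Fact p.Prime] (hp2 : p ≠ 2)
    (ψ : AddChar (ZMod p) ℂ) (hψ : ψ ≠ 1)
    (D : ZMod p) (hD : ¬ IsSquare D)
    (X Y Z W : ZMod p) (hdet : X * W - Y * Z = 1)
    (a b : ZMod p) (hab : a ^ 2 - D * b ^ 2 = 1) (hb : b ≠ 0) :
    W ^ 2 - D * Z ^ 2 ≠ 0 ∧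
    (!![X, Y; Z, W] * !![a, b * D; b, a] * (!![X, Y; Z, W])⁻¹ :
        Matrix (Fin 2) (Fin 2) (ZMod p)) 1 0 = b * (W ^ 2 - D * Z ^ 2) ∧
    b * (W ^ 2 - D * Z ^ 2) ≠ 0 ∧
    ∀ i x : ZMod p,
      WeilOp p ψ (!![X, Y; Z, W] * !![a, b * D; b, a] * (!![X, Y; Z, W])⁻¹)
          (deltaF p i) x =
        quadChar p (W ^ 2 - D * Z ^ 2) *
          ψ ((Y * W - D * X * Z) * (x ^ 2 - i ^ 2) / (W ^ 2 - D * Z ^ 2)) *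
          (gaussSum' p ψ / Real.sqrt p) * quadChar p (-b) *
          ψ ((a * (x ^ 2 + i ^ 2) - 2 * x * i) / (b * (W ^ 2 - D * Z ^ 2))) := by
  have hN : W ^ 2 - D * Z ^ 2 ≠ 0 := by
    refine sq_sub_mul_sq_ne_zero hD ?_
    by_contra! h
    simp [h.1, h.2] at hdet
  rw [conj_torus_eq hdet]
  refine ⟨hN, rfl, mul_ne_zero hb hN, fun i x => ?_⟩
  rw [weilOp_deltaF]
  simp only [Matrix.of_apply, Matrix.cons_val', Matrix.cons_val_zero, Matrix.cons_val_one,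
    Matrix.cons_val_fin_one]
  have harg : ((a + b * (Y * W - D * X * Z)) * x ^ 2 + (a - b * (Y * W - D * X * Z)) * i ^ 2
        - 2 * x * i) / (b * (W ^ 2 - D * Z ^ 2)) =
      (Y * W - D * X * Z) * (x ^ 2 - i ^ 2) / (W ^ 2 - D * Z ^ 2) +
        (a * (x ^ 2 + i ^ 2) - 2 * x * i) / (b * (W ^ 2 - D * Z ^ 2)) := by
    field_simp
    ring
  rw [harg, AddChar.map_add_eq_mul, ← neg_mul, quadChar_mul]
  ring
end

section
/- Let A ∈ SL₂(F_p) have irreducible characteristic polynomial over F_p, let C_A be its centralizer in SL₂(F_p), and let C_A' = C_A \ {I, −I} (every element of C_A' has nonzero lower-left entry). Then for any function ν : C_A' → ℂ and any ε ∈ ℂ, the set V = {φ ∈ H_p : T_B φ = ν(B)·φ for all B ∈ C_A', and Λ(−1)·φ(−x) = ε·φ(x) for all x ∈ F_p} is a ℂ-linear subspace of H_p of dimension at most 1 (the Hecke eigenspaces are at most one-dimensional in the inert case). -/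
open Finset

open Matrix
open scoped ComplexOrder

/-- Bessel's inequality, summed over the rows of a matrix acting as a scalar on a subspace. -/
theorem norm_sq_mul_finrank_le_sum_norm_sq {n : Type*} [Fintype n]
    (K : Matrix n n ℂ) (c : ℂ) (V : Submodule ℂ (n → ℂ)) (hK : ∀ φ ∈ V, K *ᵥ φ = c • φ) :
    ‖c‖ ^ 2 * Module.finrank ℂ V ≤ ∑ x, ∑ i, ‖K x i‖ ^ 2 := by
  let e := (WithLp.linearEquiv 2 ℂ (n → ℂ)).symm
  let W : Submodule ℂ (EuclideanSpace ℂ n) := V.map (e : (n → ℂ) →ₗ[ℂ] EuclideanSpace ℂ n)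
  have hfr : Module.finrank ℂ W = Module.finrank ℂ V := LinearEquiv.finrank_map_eq e V
  let b := stdOrthonormalBasis ℂ W
  have hb : Orthonormal ℂ (fun r => (b r : EuclideanSpace ℂ n)) :=
    b.orthonormal.comp_linearIsometry W.subtypeₗᵢ
  have hmem (r) : (b r : EuclideanSpace ℂ n).ofLp ∈ V := by
    obtain ⟨v, hv, hve⟩ := (b r).2
    rw [← hve]
    exact hv
  have hrow (x : n) : ∑ r, ‖c * (b r : EuclideanSpace ℂ n) x‖ ^ 2 ≤ ∑ i, ‖K x i‖ ^ 2 := by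
    have h := hb.sum_inner_products_le (WithLp.toLp 2 fun i => star (K x i)) (s := univ)
    rw [EuclideanSpace.norm_sq_eq] at h
    simp only [norm_star] at h
    refine le_trans (le_of_eq ?_) h
    refine sum_congr rfl fun r _ => ?_
    rw [norm_inner_symm]
    congr 2
    have h2 := congrFun (hK _ (hmem r)) x
    simp only [Pi.smul_apply, smul_eq_mul] at h2
    rw [← h2]
    simp [Matrix.mulVec, dotProduct, PiLp.inner_apply, mul_comm]
  have hnorm (r) : ∑ x, ‖c * (b r : EuclideanSpace ℂ n) x‖ ^ 2 = ‖c‖ ^ 2 := by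
    simp only [norm_mul, mul_pow, ← mul_sum]
    rw [← EuclideanSpace.norm_sq_eq, hb.1 r]
    simp
  calc ‖c‖ ^ 2 * Module.finrank ℂ V
      = ∑ r, ∑ x, ‖c * (b r : EuclideanSpace ℂ n) x‖ ^ 2 := by
        simp only [hnorm, hfr, sum_const, card_univ, Fintype.card_fin, nsmul_eq_mul, mul_comm]
    _ = ∑ x, ∑ r, ‖c * (b r : EuclideanSpace ℂ n) x‖ ^ 2 := sum_comm
    _ ≤ _ := sum_le_sum fun x _ => hrow x

/-- The Hilbert–Schmidt norm of a combination, with unimodular coefficients, of matrices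
that are almost orthogonal to each other. -/
theorem sum_norm_sq_sum_smul_le {ι n : Type*} [Fintype ι] [DecidableEq ι] [Fintype n]
    (k : ι → Matrix n n ℂ) (w : ι → ℂ) (hw : ∀ j, ‖w j‖ = 1) (D : ℝ)
    (hD : ∀ j, ∑ x, ∑ i, ‖k j x i‖ ^ 2 = D)
    (hoff : ∀ j l, j ≠ l → ‖∑ x, ∑ i, k j x i * star (k l x i)‖ ≤ 1) :
    ∑ x, ∑ i, ‖(∑ j, w j • k j) x i‖ ^ 2 ≤
      Fintype.card ι * (D + Fintype.card ι - 1) := by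
  have key : ((∑ x, ∑ i, ‖(∑ j, w j • k j) x i‖ ^ 2 : ℝ) : ℂ) =
      ∑ j, ∑ l, w j * star (w l) * ∑ x, ∑ i, k j x i * star (k l x i) := by
    push_cast
    simp only [← Complex.mul_conj', Matrix.sum_apply, Matrix.smul_apply, smul_eq_mul, map_sum,
      sum_mul_sum, map_mul]
    simp only [mul_sum]
    calc _ = ∑ x, ∑ j, ∑ i, ∑ l, w j * k j x i * (star (w l) * star (k l x i)) :=
          sum_congr rfl fun x _ => sum_comm
      _ = ∑ j, ∑ x, ∑ i, ∑ l, w j * k j x i * (star (w l) * star (k l x i)) := sum_comm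
      _ = ∑ j, ∑ x, ∑ l, ∑ i, w j * k j x i * (star (w l) * star (k l x i)) :=
          sum_congr rfl fun j _ => sum_congr rfl fun x _ => sum_comm
      _ = ∑ j, ∑ l, ∑ x, ∑ i, w j * k j x i * (star (w l) * star (k l x i)) :=
          sum_congr rfl fun j _ => sum_comm
      _ = _ := by
          exact sum_congr rfl fun j _ => sum_congr rfl fun l _ => sum_congr rfl fun x _ =>
            sum_congr rfl fun i _ => by ring
  have hnn : 0 ≤ ∑ x, ∑ i, ‖(∑ j, w j • k j) x i‖ ^ 2 := by positivity
  have hDnn (j : ι) : 0 ≤ D := by rw [← hD j]; positivity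
  calc ∑ x, ∑ i, ‖(∑ j, w j • k j) x i‖ ^ 2
      = ‖((∑ x, ∑ i, ‖(∑ j, w j • k j) x i‖ ^ 2 : ℝ) : ℂ)‖ := by
        rw [Complex.norm_real, Real.norm_of_nonneg hnn]
    _ ≤ ∑ j : ι, ∑ l : ι, (1 + if j = l then D - 1 else 0) := by
        rw [key]
        refine (norm_sum_le _ _).trans (sum_le_sum fun j _ => (norm_sum_le _ _).trans
          (sum_le_sum fun l _ => ?_))
        rw [norm_mul, norm_mul, norm_star, hw, hw, one_mul, one_mul]
        split_ifs with h
        · subst h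
          have : ∑ x, ∑ i, k j x i * star (k j x i) = (D : ℂ) := by
            rw [← hD j]
            push_cast
            simp only [← Complex.mul_conj']
            rfl
          rw [this, Complex.norm_real, Real.norm_of_nonneg (hDnn j)]
          linarith
        · simpa using hoff j l h
    _ = _ := by
        simp [sum_add_distrib]
        ring

/-- A matrix with orthonormal columns has unimodular eigenvalues. -/
theorem norm_eq_one_of_mulVec_eq_smul {n : Type*} [Fintype n] [DecidableEq n]
    {k : Matrix n n ℂ} (hk : kᴴ * k = 1) {φ : n → ℂ} (hφ : φ ≠ 0) {c : ℂ}
    (h : k *ᵥ φ = c • φ) : ‖c‖ = 1 := by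
  have h1 : star (k *ᵥ φ) ⬝ᵥ (k *ᵥ φ) = star φ ⬝ᵥ φ := by
    rw [star_mulVec, ← dotProduct_mulVec, mulVec_mulVec, hk, one_mulVec]
  have h0 : star φ ⬝ᵥ φ ≠ 0 := by
    rwa [Ne, dotProduct_star_self_eq_zero]
  rw [h, star_smul, smul_dotProduct, dotProduct_smul, smul_smul, smul_eq_mul] at h1
  have h2 : star c * c = 1 := mul_right_cancel₀ h0 (by rw [h1, one_mul])
  have h3 := congrArg norm h2
  rw [norm_mul, norm_star, norm_one] at h3
  nlinarith [norm_nonneg c]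

/-- The absolute value of a nondegenerate Gauss sum on a finite abelian group. -/
theorem norm_sq_sum_of_quadratic {M : Type*} [AddCommGroup M] [Fintype M] [DecidableEq M]
    (f : M → ℂ) (hf : ∀ z, ‖f z‖ = 1) (χ : M → AddChar M ℂ)
    (hχ : ∀ h, h ≠ 0 → χ h ≠ 1) (hadd : ∀ z h, f (z + h) = f h * χ h z * f z) :
    ‖∑ z, f z‖ ^ 2 = Fintype.card M := by
  have hfs (z : M) : f z * star (f z) = 1 := by
    have := Complex.mul_conj' (f z)
    rw [hf] at this
    simpa using this
  have h0 : f 0 * ∑ z, χ 0 z = Fintype.card M := by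
    rw [mul_sum]
    have (z : M) : f 0 * χ 0 z = 1 := by
      have := hadd z 0
      rw [add_zero] at this
      refine mul_right_cancel₀ (b := f z) (fun h => by simpa [h] using hf z) ?_
      rw [← this, one_mul]
    simp [this]
  have key : (∑ z, f z) * star (∑ z, f z) = (Fintype.card M : ℂ) := by
    calc (∑ z, f z) * star (∑ z, f z) = ∑ z, ∑ h, f (z + h) * star (f z) := by
          rw [star_sum, mul_sum]
          refine sum_congr rfl fun z _ => ?_
          rw [← sum_mul, ← Equiv.sum_comp (Equiv.addLeft z) f]
          rfl
      _ = ∑ z, ∑ h, f h * χ h z := by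
          refine sum_congr rfl fun z _ => sum_congr rfl fun h _ => ?_
          rw [hadd, mul_assoc, hfs, mul_one]
      _ = ∑ h, f h * ∑ z, χ h z := by
          rw [sum_comm]
          simp only [mul_sum]
      _ = _ := by
          rw [sum_eq_single 0, h0]
          · intro h _ hh
            rw [AddChar.sum_eq_zero_of_ne_one (hχ h hh), mul_zero]
          · simp
  have h2 := congrArg norm key
  rw [norm_mul, norm_star, Complex.norm_natCast] at h2
  rw [sq, h2]

section GaussSums

variable {p : ℕ} [Fact p.Prime]

theorem two_ne_zero_of_ne_two (hp2 : p ≠ 2) : (2 : ZMod p) ≠ 0 := by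
  exact Ring.two_ne_zero (by rwa [ZMod.ringChar_zmod_n])

theorem norm_addChar (ψ : AddChar (ZMod p) ℂ) (x : ZMod p) : ‖ψ x‖ = 1 :=
  AddChar.norm_apply ψ x

theorem star_addChar (ψ : AddChar (ZMod p) ℂ) (x : ZMod p) : star (ψ x) = ψ (-x) :=
  (AddChar.map_neg_eq_conj ψ x).symm

/-- Rescaling a nontrivial character by a nonzero factor gives a nontrivial character. -/
theorem exists_addChar_ne_one {ψ : AddChar (ZMod p) ℂ} (hψ : ψ ≠ 1) {a : ZMod p} (ha : a ≠ 0) :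
    ∃ x, ψ (a * x) ≠ 1 := by
  obtain ⟨y, hy⟩ := AddChar.ne_one_iff.1 hψ
  exact ⟨a⁻¹ * y, by rwa [mul_inv_cancel_left₀ ha]⟩

theorem norm_sum_addChar_mul_sq (hp2 : p ≠ 2) {ψ : AddChar (ZMod p) ℂ} (hψ : ψ ≠ 1)
    {a : ZMod p} (ha : a ≠ 0) : ‖∑ x, ψ (a * x ^ 2)‖ = Real.sqrt p := by
  have h2 := two_ne_zero_of_ne_two hp2
  rw [eq_comm, Real.sqrt_eq_iff_eq_sq (by positivity) (norm_nonneg _)]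
  rw [norm_sq_sum_of_quadratic _ (fun _ => norm_addChar ψ _)
    (fun h => ψ.compAddMonoidHom (AddMonoidHom.mulLeft (2 * a * h))), ZMod.card]
  · intro h hh
    obtain ⟨x, hx⟩ := exists_addChar_ne_one hψ (mul_ne_zero (mul_ne_zero h2 ha) hh)
    exact AddChar.ne_one_iff.2 ⟨x, hx⟩
  · intro z h
    simp only [AddChar.compAddMonoidHom_apply, AddMonoidHom.coe_mulLeft,
      ← AddChar.map_add_eq_mul]
    congr 1
    ring

theorem norm_sum_addChar_binary (hp2 : p ≠ 2) {ψ : AddChar (ZMod p) ℂ} (hψ : ψ ≠ 1)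
    {a b c : ZMod p} (h : a * b - c ^ 2 ≠ 0) :
    ‖∑ x, ∑ y, ψ (a * x ^ 2 + b * y ^ 2 + 2 * c * x * y)‖ = p := by
  have h2 := two_ne_zero_of_ne_two hp2
  rw [← sq_eq_sq₀ (norm_nonneg _) (by positivity), ← Fintype.sum_prod_type']
  rw [norm_sq_sum_of_quadratic (fun z : ZMod p × ZMod p => _) (fun _ => norm_addChar ψ _)
    (fun h => ψ.compAddMonoidHom
      ((AddMonoidHom.mulLeft (2 * (a * h.1 + c * h.2))).coprod
        (AddMonoidHom.mulLeft (2 * (c * h.1 + b * h.2)))))]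
  · simp [ZMod.card, sq]
  · rintro ⟨u, v⟩ huv
    by_cases h1 : a * u + c * v = 0
    · have h3 : c * u + b * v ≠ 0 := by
        intro h3
        have hu : (a * b - c ^ 2) * u = 0 := by linear_combination b * h1 - c * h3
        have hv : (a * b - c ^ 2) * v = 0 := by linear_combination a * h3 - c * h1
        exact huv (Prod.ext ((mul_eq_zero.1 hu).resolve_left h) ((mul_eq_zero.1 hv).resolve_left h))
      obtain ⟨x, hx⟩ := exists_addChar_ne_one hψ (mul_ne_zero h2 h3)
      exact AddChar.ne_one_iff.2 ⟨(0, x), by simpa using hx⟩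
    · obtain ⟨x, hx⟩ := exists_addChar_ne_one hψ (mul_ne_zero h2 h1)
      exact AddChar.ne_one_iff.2 ⟨(x, 0), by simpa using hx⟩
  · rintro ⟨x, y⟩ ⟨u, v⟩
    simp only [AddChar.compAddMonoidHom_apply, AddMonoidHom.coprod_apply,
      AddMonoidHom.coe_mulLeft, ← AddChar.map_add_eq_mul, Prod.mk_add_mk]
    congr 1
    ring

theorem norm_gaussSum' (hp2 : p ≠ 2) {ψ : AddChar (ZMod p) ℂ} (hψ : ψ ≠ 1) :
    ‖gaussSum' p ψ‖ = 1 := by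
  have hp : (0 : ℝ) < p := by exact_mod_cast (Fact.out : p.Prime).pos
  have h := norm_sum_addChar_mul_sq hp2 hψ one_ne_zero
  simp only [one_mul] at h
  rw [gaussSum', norm_mul, h, norm_inv, Complex.norm_real,
    Real.norm_of_nonneg (Real.sqrt_nonneg _), inv_mul_cancel₀ (Real.sqrt_pos.2 hp).ne']

theorem norm_quadChar {t : ZMod p} (ht : t ≠ 0) : ‖quadChar p t‖ = 1 := by
  rw [quadChar, if_neg ht]
  split_ifs <;> simp

end GaussSums

section WeilKernel

variable {p : ℕ} [Fact p.Prime]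

/-- The matrix of the operator `WeilOp p ψ M`. -/
noncomputable def weilKernel (ψ : AddChar (ZMod p) ℂ) (M : Matrix (Fin 2) (Fin 2) (ZMod p)) :
    Matrix (ZMod p) (ZMod p) ℂ :=
  fun x i => gaussSum' p ψ / Real.sqrt p * quadChar p (-(M 1 0)) *
    ψ ((M 0 0 * x ^ 2 + M 1 1 * i ^ 2 - 2 * x * i) / M 1 0)

theorem weilOp_eq_mulVec (ψ : AddChar (ZMod p) ℂ) (M : Matrix (Fin 2) (Fin 2) (ZMod p))
    (f : ZMod p → ℂ) : WeilOp p ψ M f = weilKernel ψ M *ᵥ f := by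
  ext x
  simp only [WeilOp, weilKernel, mulVec, dotProduct, mul_sum, mul_assoc]

variable {ψ : AddChar (ZMod p) ℂ} {M M' : Matrix (Fin 2) (Fin 2) (ZMod p)}

theorem norm_weilKernel_coeff (hp2 : p ≠ 2) (hψ : ψ ≠ 1) {c : ZMod p} (hc : c ≠ 0) :
    ‖gaussSum' p ψ / Real.sqrt p * quadChar p (-c)‖ = (Real.sqrt p)⁻¹ := by
  rw [norm_mul, norm_div, norm_gaussSum' hp2 hψ, norm_quadChar (neg_ne_zero.2 hc), mul_one,
    Complex.norm_real, Real.norm_of_nonneg (Real.sqrt_nonneg _), one_div]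

theorem norm_weilKernel (hp2 : p ≠ 2) (hψ : ψ ≠ 1) (hc : M 1 0 ≠ 0) (x i : ZMod p) :
    ‖weilKernel ψ M x i‖ = (Real.sqrt p)⁻¹ := by
  rw [weilKernel, norm_mul, norm_weilKernel_coeff hp2 hψ hc, norm_addChar, mul_one]

theorem sum_norm_sq_weilKernel (hp2 : p ≠ 2) (hψ : ψ ≠ 1) (hc : M 1 0 ≠ 0) :
    ∑ x, ∑ i, ‖weilKernel ψ M x i‖ ^ 2 = p := by
  have hp : (p : ℝ) ≠ 0 := by exact_mod_cast (Fact.out : p.Prime).ne_zero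
  simp only [norm_weilKernel hp2 hψ hc, inv_pow, Real.sq_sqrt (Nat.cast_nonneg p), sum_const,
    card_univ, ZMod.card, nsmul_eq_mul]
  field_simp

theorem conjTranspose_weilKernel_mul_self (hp2 : p ≠ 2) (hψ : ψ ≠ 1) (hc : M 1 0 ≠ 0) :
    (weilKernel ψ M)ᴴ * weilKernel ψ M = 1 := by
  have hp : (p : ℂ) ≠ 0 := by exact_mod_cast (Fact.out : p.Prime).ne_zero
  have h2 := two_ne_zero_of_ne_two hp2
  ext i j
  rw [mul_apply]
  simp only [conjTranspose_apply]
  rcases eq_or_ne i j with rfl | hij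
  · have (x : ZMod p) : star (weilKernel ψ M x i) * weilKernel ψ M x i = (p : ℂ)⁻¹ := by
      rw [mul_comm]
      refine (Complex.mul_conj' _).trans ?_
      rw [norm_weilKernel hp2 hψ hc, ← Complex.ofReal_pow, inv_pow,
        Real.sq_sqrt (Nat.cast_nonneg p)]
      simp
    simp only [this]
    simp [ZMod.card, hp]
  · rw [one_apply_ne hij]
    have hij' : 2 * (i - j) / M 1 0 ≠ 0 := div_ne_zero (mul_ne_zero h2 (sub_ne_zero.2 hij)) hc
    set g := gaussSum' p ψ / Real.sqrt p * quadChar p (-(M 1 0)) with hg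
    have hx (x : ZMod p) : star (weilKernel ψ M x i) * weilKernel ψ M x j =
        star g * g * ψ (M 1 1 * (j ^ 2 - i ^ 2) / M 1 0) *
          (ψ.compAddMonoidHom (AddMonoidHom.mulLeft (2 * (i - j) / M 1 0))) x := by
      simp only [weilKernel, ← hg, star_mul, star_addChar, AddChar.compAddMonoidHom_apply,
        AddMonoidHom.coe_mulLeft]
      have : ψ (-((M 0 0 * x ^ 2 + M 1 1 * i ^ 2 - 2 * x * i) / M 1 0)) *
          ψ ((M 0 0 * x ^ 2 + M 1 1 * j ^ 2 - 2 * x * j) / M 1 0) =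
          ψ (M 1 1 * (j ^ 2 - i ^ 2) / M 1 0) * ψ (2 * (i - j) / M 1 0 * x) := by
        simp only [← AddChar.map_add_eq_mul]
        congr 1
        ring
      linear_combination (star g * g) * this
    simp only [hx, ← mul_sum]
    rw [AddChar.sum_eq_zero_of_ne_one, mul_zero]
    obtain ⟨x, hx⟩ := exists_addChar_ne_one hψ hij'
    exact AddChar.ne_one_iff.2 ⟨x, hx⟩

theorem norm_trace_weilKernel (hp2 : p ≠ 2) (hψ : ψ ≠ 1) (hc : M 1 0 ≠ 0)
    (hdet : M.det = 1) (hM : (M - 1).det ≠ 0) : ‖∑ x, weilKernel ψ M x x‖ = 1 := by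
  have hp : (0 : ℝ) < p := by exact_mod_cast (Fact.out : p.Prime).pos
  have hne : (M 0 0 + M 1 1 - 2) / M 1 0 ≠ 0 := by
    refine div_ne_zero (fun h => hM ?_) hc
    rw [det_fin_two] at hdet ⊢
    simp
    linear_combination hdet - h
  have hx (x : ZMod p) : (M 0 0 * x ^ 2 + M 1 1 * x ^ 2 - 2 * x * x) / M 1 0 =
      (M 0 0 + M 1 1 - 2) / M 1 0 * x ^ 2 := by ring
  simp only [weilKernel, hx, ← mul_sum]
  rw [norm_mul, norm_weilKernel_coeff hp2 hψ hc, norm_sum_addChar_mul_sq hp2 hψ hne,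
    inv_mul_cancel₀ (Real.sqrt_pos.2 hp).ne']

theorem norm_sum_weilKernel_mul_star (hp2 : p ≠ 2) (hψ : ψ ≠ 1) (hc : M 1 0 ≠ 0)
    (hc' : M' 1 0 ≠ 0) (hdet : M.det = 1) (hdet' : M'.det = 1) (hM : (M - M').det ≠ 0) :
    ‖∑ x, ∑ i, weilKernel ψ M x i * star (weilKernel ψ M' x i)‖ = 1 := by
  have hp : (0 : ℝ) < p := by exact_mod_cast (Fact.out : p.Prime).pos
  have hne : (M 0 0 / M 1 0 - M' 0 0 / M' 1 0) * (M 1 1 / M 1 0 - M' 1 1 / M' 1 0) -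
      (1 / M' 1 0 - 1 / M 1 0) ^ 2 ≠ 0 := by
    intro h
    apply hM
    rw [det_fin_two] at hdet hdet' ⊢
    field_simp at h
    simp only [Matrix.sub_apply]
    refine (mul_eq_zero.1 (?_ : M 1 0 * M' 1 0 * _ = 0)).resolve_left (mul_ne_zero hc hc')
    linear_combination (M' 1 0 * M 1 0 - M' 1 0 ^ 2) * hdet +
      (M' 1 0 * M 1 0 - M 1 0 ^ 2) * hdet' + h
  set g := gaussSum' p ψ / Real.sqrt p * quadChar p (-(M 1 0)) with hg
  set g' := gaussSum' p ψ / Real.sqrt p * quadChar p (-(M' 1 0)) with hg'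
  have hx (x i : ZMod p) : weilKernel ψ M x i * star (weilKernel ψ M' x i) =
      g * star g' * ψ ((M 0 0 / M 1 0 - M' 0 0 / M' 1 0) * x ^ 2 +
        (M 1 1 / M 1 0 - M' 1 1 / M' 1 0) * i ^ 2 + 2 * (1 / M' 1 0 - 1 / M 1 0) * x * i) := by
    simp only [weilKernel, ← hg, ← hg', star_mul, star_addChar]
    have : ψ ((M 0 0 * x ^ 2 + M 1 1 * i ^ 2 - 2 * x * i) / M 1 0) *
        ψ (-((M' 0 0 * x ^ 2 + M' 1 1 * i ^ 2 - 2 * x * i) / M' 1 0)) =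
        ψ ((M 0 0 / M 1 0 - M' 0 0 / M' 1 0) * x ^ 2 +
        (M 1 1 / M 1 0 - M' 1 1 / M' 1 0) * i ^ 2 + 2 * (1 / M' 1 0 - 1 / M 1 0) * x * i) := by
      simp only [← AddChar.map_add_eq_mul]
      congr 1
      ring
    linear_combination (g * star g') * this
  simp only [hx, ← mul_sum]
  rw [norm_mul, norm_mul, norm_star, hg, hg', norm_weilKernel_coeff hp2 hψ hc,
    norm_weilKernel_coeff hp2 hψ hc', norm_sum_addChar_binary hp2 hψ hne, ← mul_inv,
    Real.mul_self_sqrt hp.le, inv_mul_cancel₀ hp.ne']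

end WeilKernel

/-- The norm form of the field generated by `A` is anisotropic. -/
theorem eq_zero_of_normForm_eq_zero {F : Type*} [Field F] {A : Matrix (Fin 2) (Fin 2) F}
    (hA : Irreducible A.charpoly) {x y : F}
    (h : x ^ 2 + A.trace * x * y + A.det * y ^ 2 = 0) : x = 0 ∧ y = 0 := by
  have hroot (r : F) : ¬ A.charpoly.IsRoot r := fun hr => by
    have := Polynomial.degree_eq_one_of_irreducible_of_root hA hr
    rw [charpoly_degree_eq_dim] at this
    norm_num at this
  have hy : y = 0 := by
    by_contra hy
    refine hroot (-x / y) ?_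
    rw [charpoly_fin_two, Polynomial.IsRoot.def]
    simp
    field_simp
    linear_combination h
  subst hy
  simpa using h

theorem lowerLeft_ne_zero_of_irreducible_charpoly {F : Type*} [Field F]
    {A : Matrix (Fin 2) (Fin 2) F} (hA : Irreducible A.charpoly) : A 1 0 ≠ 0 := by
  intro h
  have := (eq_zero_of_normForm_eq_zero hA (x := -A 0 0) (y := 1) (by
    rw [trace_fin_two, det_fin_two]
    linear_combination (-A 0 1) * h)).2
  exact one_ne_zero this

/-- The norm-one torus of a quadratic field extension has at least `#F` elements other than
`-1`: there is a family, indexed by `F`, whose differences are invertible. -/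
theorem exists_torus_family {F : Type*} [Field F] (h2 : (2 : F) ≠ 0)
    (A : SpecialLinearGroup (Fin 2) F)
    (hA : Irreducible (A : Matrix (Fin 2) (Fin 2) F).charpoly) :
    ∃ M : F → SpecialLinearGroup (Fin 2) F, (∀ s, A * M s = M s * A) ∧
      (∀ s, (M s : Matrix (Fin 2) (Fin 2) F) 1 0 = 0 →
        (M s : Matrix (Fin 2) (Fin 2) F) = 1) ∧
      ∀ s r, s ≠ r → ((M s : Matrix (Fin 2) (Fin 2) F) - M r).det ≠ 0 := by
  have hc := lowerLeft_ne_zero_of_irreducible_charpoly hA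
  obtain ⟨A, hdet⟩ := A
  simp only at hA hc
  have hform {x y : F} (h : x ^ 2 + A.trace * x * y + y ^ 2 = 0) : x = 0 ∧ y = 0 :=
    eq_zero_of_normForm_eq_zero hA (by rw [hdet, one_mul]; exact h)
  set t := A.trace with ht
  have hN (s : F) : s ^ 2 + s * t + 1 ≠ 0 := fun h =>
    one_ne_zero (hform (x := s) (y := 1) (by linear_combination h)).2
  have hdet_lin (x y : F) : (x • (1 : Matrix (Fin 2) (Fin 2) F) + y • A).det =
      x ^ 2 + t * x * y + y ^ 2 := by
    rw [det_fin_two] at hdet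
    rw [ht, trace_fin_two, det_fin_two]
    simp
    linear_combination y ^ 2 * hdet
  let x (s : F) : F := (1 - s ^ 2) / (s ^ 2 + s * t + 1)
  let y (s : F) : F := -(2 * s + t) / (s ^ 2 + s * t + 1)
  have hx (s : F) : x s * (s ^ 2 + s * t + 1) = 1 - s ^ 2 := div_mul_cancel₀ _ (hN s)
  have hy (s : F) : y s * (s ^ 2 + s * t + 1) = -(2 * s + t) := div_mul_cancel₀ _ (hN s)
  have hxy (s : F) : s * y s - (x s + 1) = -2 := by
    refine mul_right_cancel₀ (hN s) ?_
    linear_combination s * hy s - hx s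
  refine ⟨fun s => ⟨x s • (1 : Matrix (Fin 2) (Fin 2) F) + y s • A, ?_⟩, ?_, ?_, ?_⟩
  · refine (hdet_lin _ _).trans (mul_right_cancel₀ (pow_ne_zero 2 (hN s)) ?_)
    linear_combination (x s * (s ^ 2 + s * t + 1) + (1 - s ^ 2) +
      t * y s * (s ^ 2 + s * t + 1)) * hx s +
      (t * (1 - s ^ 2) + y s * (s ^ 2 + s * t + 1) - (2 * s + t)) * hy s
  · intro s
    refine Subtype.ext ?_
    change A * (x s • 1 + y s • A) = (x s • 1 + y s • A) * A
    simp [mul_add, add_mul]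
  · intro s hs
    have hy : y s = 0 := by simpa [hc] using hs
    have hx : x s = 1 := by
      have := hxy s
      rw [hy] at this
      linear_combination -this
    simp [hx, hy]
  · intro s r hsr h
    have hsub : x s • (1 : Matrix (Fin 2) (Fin 2) F) + y s • A - (x r • 1 + y r • A) =
        (x s - x r) • (1 : Matrix (Fin 2) (Fin 2) F) + (y s - y r) • A := by
      simp only [sub_smul]
      abel
    simp only [hsub, hdet_lin] at h
    obtain ⟨hx, hy⟩ := hform h
    have hy0 : y s = 0 := by
      refine (mul_eq_zero.1 (?_ : (s - r) * y s = 0)).resolve_left (sub_ne_zero.2 hsr)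
      linear_combination hxy s - hxy r + hx - r * hy
    have hy' : y r = 0 := by linear_combination hy0 - hy
    have hs : -(2 * s + t) = 0 := (div_eq_zero_iff.1 hy0).resolve_right (hN s)
    have hr : -(2 * r + t) = 0 := (div_eq_zero_iff.1 hy').resolve_right (hN r)
    refine sub_ne_zero.2 hsr ((mul_eq_zero.1 (?_ : 2 * (s - r) = 0)).resolve_left h2)
    linear_combination hr - hs

/-- In the inert case, each joint Hecke eigenspace is a linear subspace of
`H_p` of dimension at most one. -/
theorem hecke_eigenspace_dim_le_one
    (p : ℕ) [Fact p.Prime] (hp2 : p ≠ 2)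
    (ψ : AddChar (ZMod p) ℂ) (hψ : ψ ≠ 1)
    (A : Matrix.SpecialLinearGroup (Fin 2) (ZMod p))
    (hA : Irreducible (Matrix.charpoly (A : Matrix (Fin 2) (Fin 2) (ZMod p))))
    (ν : Matrix.SpecialLinearGroup (Fin 2) (ZMod p) → ℂ) (ε : ℂ) :
    ∃ V : Submodule ℂ (ZMod p → ℂ),
      (V : Set (ZMod p → ℂ)) =
        {φ : ZMod p → ℂ |
          (∀ B : Matrix.SpecialLinearGroup (Fin 2) (ZMod p),
            A * B = B * A → (B : Matrix (Fin 2) (Fin 2) (ZMod p)) ≠ 1 →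
            (B : Matrix (Fin 2) (Fin 2) (ZMod p)) ≠ -1 →
            ∀ x : ZMod p,
              WeilOp p ψ (B : Matrix (Fin 2) (Fin 2) (ZMod p)) φ x = ν B * φ x) ∧
          (∀ x : ZMod p, quadChar p (-1) * φ (-x) = ε * φ x)} ∧
      Module.finrank ℂ V ≤ 1 := by
  classical
  have h2 := two_ne_zero_of_ne_two hp2
  have hp : 0 < p := (Fact.out : p.Prime).pos
  simp only [weilOp_eq_mulVec]
  let V : Submodule ℂ (ZMod p → ℂ) :=
    { carrier := {φ : ZMod p → ℂ |
        (∀ B : Matrix.SpecialLinearGroup (Fin 2) (ZMod p),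
          A * B = B * A → (B : Matrix (Fin 2) (Fin 2) (ZMod p)) ≠ 1 →
          (B : Matrix (Fin 2) (Fin 2) (ZMod p)) ≠ -1 →
          ∀ x : ZMod p,
            (weilKernel ψ (B : Matrix (Fin 2) (Fin 2) (ZMod p)) *ᵥ φ) x = ν B * φ x) ∧
        (∀ x : ZMod p, quadChar p (-1) * φ (-x) = ε * φ x)}
      zero_mem' := by simp
      add_mem' := by
        rintro f g ⟨hf, hf'⟩ ⟨hg, hg'⟩
        refine ⟨fun B h h1 h3 x => ?_, fun x => ?_⟩
        · rw [mulVec_add, Pi.add_apply, hf B h h1 h3, hg B h h1 h3, Pi.add_apply, mul_add]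
        · rw [Pi.add_apply, Pi.add_apply, mul_add, hf', hg', mul_add]
      smul_mem' := by
        rintro a f ⟨hf, hf'⟩
        refine ⟨fun B h h1 h3 x => ?_, fun x => ?_⟩
        · rw [mulVec_smul, Pi.smul_apply, hf B h h1 h3, Pi.smul_apply, smul_eq_mul, smul_eq_mul]
          ring
        · rw [Pi.smul_apply, Pi.smul_apply, smul_eq_mul, smul_eq_mul]
          linear_combination a * hf' x }
  refine ⟨V, rfl, ?_⟩
  rcases eq_or_ne V ⊥ with hV | hV
  · rw [hV, finrank_bot]
    exact zero_le_one
  obtain ⟨φ₀, hφ₀, hne⟩ := V.exists_mem_ne_zero_of_ne_bot hV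
  obtain ⟨M, hcomm, hone, hdiff⟩ := exists_torus_family h2 A hA
  let c (s : ZMod p) : ZMod p := (M s : Matrix (Fin 2) (Fin 2) (ZMod p)) 1 0
  let k (s : ZMod p) : Matrix (ZMod p) (ZMod p) ℂ :=
    if c s = 0 then 1 else weilKernel ψ (M s : Matrix (Fin 2) (Fin 2) (ZMod p))
  let μ (s : ZMod p) : ℂ := if c s = 0 then 1 else ν (M s)
  have hk (s : ZMod p) (φ : ZMod p → ℂ) (hφ : φ ∈ V) : k s *ᵥ φ = μ s • φ := by
    by_cases hs : c s = 0
    · simp [k, μ, hs]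
    · simp only [k, μ, hs, if_false]
      ext x
      refine hφ.1 (M s) (hcomm s) (fun h => hs ?_) (fun h => hs ?_) x <;> simp [c, h]
  have hμ (s : ZMod p) : ‖μ s‖ = 1 := by
    refine norm_eq_one_of_mulVec_eq_smul ?_ hne (hk s φ₀ hφ₀)
    by_cases hs : c s = 0
    · simp [k, hs]
    · simp only [k, hs, if_false]
      exact conjTranspose_weilKernel_mul_self hp2 hψ hs
  have hD (s : ZMod p) : ∑ x, ∑ i, ‖k s x i‖ ^ 2 = (p : ℝ) := by
    by_cases hs : c s = 0
    · simp [k, hs, one_apply, apply_ite, ZMod.card]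
    · simp only [k, hs, if_false]
      exact sum_norm_sq_weilKernel hp2 hψ hs
  have hoff (s r : ZMod p) (hsr : s ≠ r) : ‖∑ x, ∑ i, k s x i * star (k r x i)‖ ≤ 1 := by
    have hd := hdiff s r hsr
    by_cases hs : c s = 0
    · by_cases hr : c r = 0
      · simp [hone s hs, hone r hr] at hd
      · have hd' := hdiff r s hsr.symm
        rw [hone s hs] at hd'
        have := norm_trace_weilKernel hp2 hψ hr (M r).det_coe hd'
        simp only [k, hs, hr, if_false, if_true, one_apply, ite_mul, one_mul, zero_mul,
          sum_ite_eq, mem_univ]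
        rw [← star_sum, norm_star, this]
    · by_cases hr : c r = 0
      · rw [hone r hr] at hd
        have := norm_trace_weilKernel hp2 hψ hs (M s).det_coe hd
        simp only [k, hs, hr, if_false, if_true, one_apply, apply_ite star, star_one, star_zero,
          mul_ite, mul_one, mul_zero, sum_ite_eq, mem_univ]
        rw [this]
      · simp only [k, hs, hr, if_false]
        exact (norm_sum_weilKernel_mul_star hp2 hψ hs hr (M s).det_coe (M r).det_coe hd).le
  have hupper := sum_norm_sq_sum_smul_le k (fun s => star (μ s))
    (fun s => by rw [norm_star, hμ]) p hD hoff
  have hlower := norm_sq_mul_finrank_le_sum_norm_sq (∑ s, star (μ s) • k s) p V (by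
    intro φ hφ
    have hs (s : ZMod p) : star (μ s) * μ s = 1 := by
      rw [mul_comm]
      refine (Complex.mul_conj' _).trans ?_
      simp [hμ]
    simp only [sum_mulVec, smul_mulVec, hk _ φ hφ, smul_smul, hs, one_smul]
    simp [ZMod.card, ← Nat.cast_smul_eq_nsmul ℂ])
  have h := hlower.trans hupper
  rw [ZMod.card, Complex.norm_natCast] at h
  have hp' : (0 : ℝ) < p := by exact_mod_cast hp
  by_contra! hlt
  have hlt' : (2 : ℝ) ≤ Module.finrank ℂ V := by exact_mod_cast hlt
  nlinarith [mul_le_mul_of_nonneg_left hlt' (sq_nonneg (p : ℝ))]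
end
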